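/- arXiv:1612.07751 — 5 statements merged into one kernel-verified Lean document; each statement's English description precedes it below -/
import Mathlib

section
/- Let b, f₁, f₂, f₃ be integers such that f₁ + f₂ + f₃ = −12b − 24 and f₁² + f₂² + f₃² = 12b² − 60. Then b = −3 and f₁ = f₂ = f₃ = 4. -/
/-- The Diophantine system determining the class M² in H⁴(X, ℤ). -/
theorem Msq_system (b f₁ f₂ f₃ : ℤ)
    (hsum : f₁ + f₂ + f₃ = -12 * b - 24)
    (hsq : f₁ ^ 2 + f₂ ^ 2 + f₃ ^ 2 = 12 * b ^ 2 - 60) :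
    b = -3 ∧ f₁ = 4 ∧ f₂ = 4 ∧ f₃ = 4 := by
  have hquad : (3 * b + 7) * (b + 3) ≤ 0 := by
    have hcs : (f₁ + f₂ + f₃) ^ 2 ≤ 3 * (f₁ ^ 2 + f₂ ^ 2 + f₃ ^ 2) := by
      linarith [sq_nonneg (f₁ - f₂), sq_nonneg (f₂ - f₃), sq_nonneg (f₁ - f₃)]
    rw [hsum, hsq] at hcs
    linarith
  have hb : b = -3 := by
    have hlower : -3 ≤ b := by
      by_contra! h
      nlinarith
    have hupper : b < -2 := by
      by_contra! h
      nlinarith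
    omega
  subst hb
  have hzero : (f₁ - 4) ^ 2 + (f₂ - 4) ^ 2 + (f₃ - 4) ^ 2 = 0 := by
    linarith
  have h_eq {x : ℤ} (h : (x - 4) ^ 2 ≤ 0) : x = 4 :=
    sub_eq_zero.mp (sq_nonpos_iff _ |>.mp h)
  refine ⟨rfl, h_eq ?_, h_eq ?_, h_eq ?_⟩ <;>
    linarith [sq_nonneg (f₁ - 4), sq_nonneg (f₂ - 4), sq_nonneg (f₃ - 4)]
end

section
/- Let b, f₁, f₂, f₃, g₁, g₂, g₃ be integers such that f₁ + f₂ + f₃ = −12b − 132, g₁ + g₂ + g₃ = 6b + 138, and f₁² + f₂² + f₃² + g₁² + g₂² + g₃² = 12b² − 1308. Then b = −17, f₁ = f₂ = f₃ = 24, and g₁ = g₂ = g₃ = 12. -/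
/-- The Cauchy–Schwarz inequality against the vector `(1, 1, 1)`. -/
theorem sq_add_add_le_three_mul (x y z : ℤ) :
    (x + y + z) ^ 2 ≤ 3 * (x ^ 2 + y ^ 2 + z ^ 2) := by
  linarith [sq_nonneg (x - y), sq_nonneg (y - z), sq_nonneg (z - x)]

/-- The Diophantine system determining the class H̃_M in H⁴(X, ℤ). -/
theorem HM_system (b f₁ f₂ f₃ g₁ g₂ g₃ : ℤ)
    (hf : f₁ + f₂ + f₃ = -12 * b - 132)
    (hg : g₁ + g₂ + g₃ = 6 * b + 138)
    (hsq : f₁ ^ 2 + f₂ ^ 2 + f₃ ^ 2 + g₁ ^ 2 + g₂ ^ 2 + g₃ ^ 2 = 12 * b ^ 2 - 1308) :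
    b = -17 ∧ f₁ = 24 ∧ f₂ = 24 ∧ f₃ = 24 ∧ g₁ = 12 ∧ g₂ = 12 ∧ g₃ = 12 := by
  have hF := sq_add_add_le_three_mul f₁ f₂ f₃
  have hG := sq_add_add_le_three_mul g₁ g₂ g₃
  rw [hf] at hF
  rw [hg] at hG
  have hb : (b + 17) * (2 * b + 33) ≤ 0 := by linarith
  obtain rfl : b = -17 := by
    apply le_antisymm
    · by_contra! h
      have := mul_pos (show 0 < b + 17 by lia) (show 0 < 2 * b + 33 by lia)
      lia
    · by_contra! h
      have := mul_pos_of_neg_of_neg (show b + 17 < 0 by lia) (show 2 * b + 33 < 0 by lia)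
      lia
  have hzero : (f₁ - 24) ^ 2 + (f₂ - 24) ^ 2 + (f₃ - 24) ^ 2
      + (g₁ - 12) ^ 2 + (g₂ - 12) ^ 2 + (g₃ - 12) ^ 2 = 0 := by
    linarith
  have h₁ := sq_nonneg (f₁ - 24)
  have h₂ := sq_nonneg (f₂ - 24)
  have h₃ := sq_nonneg (f₃ - 24)
  have h₄ := sq_nonneg (g₁ - 12)
  have h₅ := sq_nonneg (g₂ - 12)
  have h₆ := sq_nonneg (g₃ - 12)
  refine ⟨rfl, ?_, ?_, ?_, ?_, ?_, ?_⟩ <;>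
    exact sub_eq_zero.mp (pow_eq_zero_iff two_ne_zero |>.mp (by linarith))
end

section
/- Let A, B ∈ ℂ[X₀, …, X₄] with B ≠ 0, and suppose that for each i ∈ {0, …, 4} there exists a polynomial Lᵢ of degree at most 1 such that A·Xᵢ = B·Lᵢ. Then there exists a scalar c ∈ ℂ with A = c·B. -/
open MvPolynomial

/-- If `A * X i` and `A * X j` are both multiples of `B ≠ 0` for distinct variables, and the first
quotient has degree at most one, then `A` is a scalar multiple of `B`. -/
theorem MvPolynomial.eq_C_mul_of_mul_X_eq {σ R : Type*} [CommRing R] [IsDomain R]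
    {A B L M : MvPolynomial σ R} {i j : σ} (hij : i ≠ j) (hB : B ≠ 0)
    (hdeg : L.totalDegree ≤ 1) (hL : A * X i = B * L) (hM : A * X j = B * M) :
    ∃ c : R, A = C c * B := by
  have hLM : X j * L = X i * M := mul_left_cancel₀ hB (by linear_combination X i * hM - X j * hL)
  have hdvd : X i ∣ L := (X_dvd_mul_iff.mp ⟨M, hLM⟩).resolve_left fun h => hij (X_dvd_X.mp h)
  obtain ⟨Q, rfl⟩ := hdvd
  have hA : A = B * Q := mul_right_cancel₀ (X_ne_zero i) (by linear_combination hL)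
  have hQ : Q.totalDegree = 0 := by
    rcases eq_or_ne Q 0 with rfl | hQ
    · exact totalDegree_zero
    · rw [totalDegree_mul_of_isDomain (X_ne_zero i) hQ, totalDegree_X] at hdeg
      omega
  exact ⟨coeff 0 Q, by rw [← totalDegree_eq_zero_iff_eq_C.mp hQ, hA, mul_comm]⟩

/-- If `B ≠ 0` and for each variable `Xᵢ` there is a polynomial `Lᵢ` of degree at most 1
with `A·Xᵢ = B·Lᵢ`, then `A` is a scalar multiple of `B`. -/
theorem proportional_of_linear_quotients (A B : MvPolynomial (Fin 5) ℂ) (hB : B ≠ 0)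
    (h : ∀ i : Fin 5, ∃ L : MvPolynomial (Fin 5) ℂ,
      L.totalDegree ≤ 1 ∧ A * X i = B * L) :
    ∃ c : ℂ, A = C c * B := by
  obtain ⟨L, hdeg, hL⟩ := h 0
  obtain ⟨M, -, hM⟩ := h 1
  exact eq_C_mul_of_mul_X_eq zero_ne_one hB hdeg hL hM
end

section
/- Let A, B ∈ ℂ[X₀, …, X₄] be homogeneous polynomials of degree 4 that are linearly independent over ℂ. Then there exists an index i ∈ {0, …, 4} such that the six polynomials A²Xᵢ, ABX₀, ABX₁, ABX₂, ABX₃, ABX₄ are linearly independent over ℂ. -/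
open MvPolynomial

/-- If `A`, `B` are nonzero and `A²Xᵢ, ABX₀, …, ABX₄` are linearly dependent, then `A Xᵢ` is the
product of `B` with a linear form. -/
lemma exists_mul_X_eq_mul_linear_of_not_linearIndependent {A B : MvPolynomial (Fin 5) ℂ}
    (hA : A ≠ 0) (hB : B ≠ 0) {i : Fin 5}
    (h : ¬ LinearIndependent ℂ
      ![A ^ 2 * X i, A * B * X 0, A * B * X 1, A * B * X 2, A * B * X 3, A * B * X 4]) :
    ∃ c : Fin 5 → ℂ, A * X i = B * ∑ j, C (c j) * X j := by
  rw [Fintype.linearIndependent_iff] at h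
  push Not at h
  obtain ⟨g, hg, k, hk⟩ := h
  have hrel : C (g 0) * (A * X i) + B * ∑ j : Fin 5, C (g j.succ) * X j = 0 := by
    apply mul_left_cancel₀ hA
    rw [mul_zero, ← hg]
    simp only [Fin.sum_univ_succ, smul_eq_C_mul]
    simp
    ring
  have h0 : g 0 ≠ 0 := by
    intro h0
    rw [h0, C_0, zero_mul, zero_add] at hrel
    have hlin := (mul_eq_zero.mp hrel).resolve_left hB
    apply hk
    refine Fin.cases h0 (fun j => ?_) k
    simpa [Pi.single_apply] using congrArg (eval (Pi.single j (1 : ℂ))) hlin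
  refine ⟨fun j => -(g 0)⁻¹ * g j.succ, ?_⟩
  have hinv : C (g 0)⁻¹ * C (g 0) = (1 : MvPolynomial (Fin 5) ℂ) := by
    rw [← C_mul, inv_mul_cancel₀ h0, C_1]
  simp only [C_mul, C_neg, mul_assoc, ← Finset.mul_sum]
  linear_combination C (g 0)⁻¹ * hrel - A * X i * hinv

/-- If linear forms satisfy `L X₁ = L' X₀`, then `L` is a multiple of `X₀`. -/
lemma coeff_eq_zero_of_linear_mul_X_one_eq {c d : Fin 5 → ℂ}
    (h : (∑ j, C (c j) * X j) * X 1 = (∑ j, C (d j) * X j) * (X 0 : MvPolynomial (Fin 5) ℂ))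
    {j : Fin 5} (hj : j ≠ 0) : c j = 0 := by
  have h1 : c 1 = 0 := by
    simpa [Pi.single_apply] using congrArg (eval (Pi.single 1 (1 : ℂ))) h
  by_cases hj1 : j = 1
  · rw [hj1, h1]
  · have hp := congrArg
      (eval fun k : Fin 5 => (if k = 1 then (1 : ℂ) else 0) + if k = j then 1 else 0) h
    simpa [mul_add, Finset.sum_add_distrib, h1, hj.symm, Ne.symm hj1] using hp

/-- If `A`, `B` are linearly independent homogeneous quartics in `ℂ[X₀, …, X₄]`, then for
some `i` the six polynomials `A²Xᵢ, ABX₀, …, ABX₄` are linearly independent over `ℂ`. -/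
theorem six_independent_nonics (A B : MvPolynomial (Fin 5) ℂ)
    (hA : A.IsHomogeneous 4) (hB : B.IsHomogeneous 4)
    (hind : LinearIndependent ℂ ![A, B]) :
    ∃ i : Fin 5, LinearIndependent ℂ
      ![A ^ 2 * X i, A * B * X 0, A * B * X 1, A * B * X 2, A * B * X 3, A * B * X 4] := by
  have hA0 : A ≠ 0 := hind.ne_zero 0
  have hB0 : B ≠ 0 := hind.ne_zero 1
  by_contra! h
  obtain ⟨c, hc⟩ := exists_mul_X_eq_mul_linear_of_not_linearIndependent hA0 hB0 (h 0)
  obtain ⟨d, hd⟩ := exists_mul_X_eq_mul_linear_of_not_linearIndependent hA0 hB0 (h 1)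
  have hcd : (∑ j, C (c j) * X j) * X 1 =
      (∑ j, C (d j) * X j) * (X 0 : MvPolynomial (Fin 5) ℂ) := by
    apply mul_left_cancel₀ hB0
    linear_combination X 0 * hd - X 1 * hc
  have hsum : ∑ j, C (c j) * X j = C (c 0) * (X 0 : MvPolynomial (Fin 5) ℂ) :=
    Fintype.sum_eq_single 0 fun j hj => by
      rw [coeff_eq_zero_of_linear_mul_X_one_eq hcd hj, C_0, zero_mul]
  rw [hsum] at hc
  have hAB : A = B * C (c 0) := by
    apply mul_right_cancel₀ (X_ne_zero (R := ℂ) (0 : Fin 5))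
    rw [hc, mul_assoc]
  have hzero := LinearIndependent.pair_iff.mp hind 1 (-c 0) (by
    rw [one_smul, smul_eq_C_mul, C_neg]
    linear_combination hAB)
  exact one_ne_zero hzero.1
end

section
/- Let b, f₁, f₂, f₃ be integers satisfying 3(f₁² + f₂² + f₃²) ≥ (f₁ + f₂ + f₃)², f₁ + f₂ + f₃ = −12b − 24, and f₁² + f₂² + f₃² = 12b² − 60. Then (3b + 7)(b + 3) ≤ 0, and the only integer b in this range is b = −3; moreover, equality holds in the Cauchy–Schwarz inequality, forcing f₁ = f₂ = f₃. -/
/-- Solving the system for M² via Cauchy–Schwarz: the inequality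
3(f₁² + f₂² + f₃²) ≥ (f₁ + f₂ + f₃)² together with the two Diophantine equations gives
(3b + 7)(b + 3) ≤ 0, whence b = −3, equality in Cauchy–Schwarz, and f₁ = f₂ = f₃. -/
theorem Msq_cauchy_schwarz_steps (b f₁ f₂ f₃ : ℤ)
    (hCS : (f₁ + f₂ + f₃) ^ 2 ≤ 3 * (f₁ ^ 2 + f₂ ^ 2 + f₃ ^ 2))
    (hsum : f₁ + f₂ + f₃ = -12 * b - 24)
    (hsq : f₁ ^ 2 + f₂ ^ 2 + f₃ ^ 2 = 12 * b ^ 2 - 60) :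
    (3 * b + 7) * (b + 3) ≤ 0 ∧ b = -3 ∧
    (f₁ + f₂ + f₃) ^ 2 = 3 * (f₁ ^ 2 + f₂ ^ 2 + f₃ ^ 2) ∧ f₁ = f₂ ∧ f₂ = f₃ := by
  have hb : (3 * b + 7) * (b + 3) ≤ 0 := by
    rw [hsum, hsq] at hCS
    linarith
  obtain rfl : b = -3 := by
    have hlower : -3 ≤ b := by
      by_contra! h
      nlinarith
    have hupper : b < -2 := by
      by_contra! h
      nlinarith
    omega
  have hzero : (f₁ - 4) ^ 2 + (f₂ - 4) ^ 2 + (f₃ - 4) ^ 2 = 0 := by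
    linarith
  have h₁ : f₁ - 4 = 0 := by
    rw [← sq_eq_zero_iff]
    linarith [sq_nonneg (f₁ - 4), sq_nonneg (f₂ - 4), sq_nonneg (f₃ - 4)]
  have h₂ : f₂ - 4 = 0 := by
    rw [← sq_eq_zero_iff]
    linarith [sq_nonneg (f₁ - 4), sq_nonneg (f₂ - 4), sq_nonneg (f₃ - 4)]
  refine ⟨hb, rfl, ?_, by linarith, by linarith⟩
  rw [hsum, hsq]
  norm_num
end
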